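/- For every compact set K in the plane and radii 0 < r0 ≤ r1, the integral over r in [r0, r1] of the first Betti number of the r-offset K^r = {x : dist(x,K) ≤ r} is bounded above by the Lebesgue area of K^{r1} divided by 2π r0. -/

import Mathlib

open MeasureTheory Metric

/-- The plane `ℝ²`. -/
abbrev Plane := EuclideanSpace ℝ (Fin 2)

/-- The first Betti number of a planar set, defined as the number of bounded connected
components of its complement. -/
noncomputable def betti1 (A : Set Plane) : ℕ :=
  Nat.card {C : ConnectedComponents ↥(Aᶜ) //
    Bornology.IsBounded ((Subtype.val '' (ConnectedComponents.mk ⁻¹' {C})) : Set Plane)}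

open scoped RealInnerProductSpace

/-- The area-preserving map sending the circle of radius `r` about the origin to the circle of
radius `√(a + r²)` about `y`, preserving the outward normal direction. -/
noncomputable def expandMap (a : ℝ) (y w : Plane) : Plane :=
  y + √(1 + a / ‖w‖ ^ 2) • w

/-- `‖w‖` times the support function of the closed ball of centre `y` and radius `√(a + ‖w‖²)`
in direction `w / ‖w‖`. -/
noncomputable def ballSupport (a : ℝ) (y w : Plane) : ℝ :=
  ⟪w, y⟫ + ‖w‖ * √(a + ‖w‖ ^ 2)

lemma sqrt_mul_norm_eq (a : ℝ) {w : Plane} (hw : w ≠ 0) :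
    √(1 + a / ‖w‖ ^ 2) * ‖w‖ = √(a + ‖w‖ ^ 2) := by
  have hn : 0 < ‖w‖ := norm_pos_iff.mpr hw
  rw [← Real.sqrt_sq hn.le, ← Real.sqrt_mul' _ (sq_nonneg _), Real.sqrt_sq hn.le]
  congr 1
  field_simp
  ring

lemma dist_expandMap_center {a : ℝ} (y : Plane) {w : Plane} (hw : w ≠ 0) :
    ‖expandMap a y w - y‖ = √(a + ‖w‖ ^ 2) := by
  rw [expandMap, add_sub_cancel_left, norm_smul, Real.norm_of_nonneg (Real.sqrt_nonneg _),
    sqrt_mul_norm_eq a hw]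

lemma inner_expandMap (a : ℝ) (y : Plane) {w : Plane} (hw : w ≠ 0) :
    ⟪w, expandMap a y w⟫ = ballSupport a y w := by
  rw [expandMap, ballSupport, inner_add_right, inner_smul_right, real_inner_self_eq_norm_sq,
    ← sqrt_mul_norm_eq a hw]
  ring

lemma mul_sqrt_le_inner_expandMap_sub {a b : ℝ} {y x w : Plane} (hw : w ≠ 0)
    (h : ballSupport b x w ≤ ballSupport a y w) :
    ‖w‖ * √(b + ‖w‖ ^ 2) ≤ ⟪w, expandMap a y w - x⟫ := by
  rw [inner_sub_right, inner_expandMap a y hw]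
  unfold ballSupport at *
  linarith

lemma sqrt_le_norm_expandMap_sub {a b : ℝ} {y x w : Plane} (hw : w ≠ 0)
    (h : ballSupport b x w ≤ ballSupport a y w) :
    √(b + ‖w‖ ^ 2) ≤ ‖expandMap a y w - x‖ :=
  le_of_mul_le_mul_left
    ((mul_sqrt_le_inner_expandMap_sub hw h).trans (real_inner_le_norm _ _))
    (norm_pos_iff.mpr hw)

lemma expandMap_injective {a b : ℝ} {y x w v : Plane} (ha : 0 ≤ a) (hb : 0 ≤ b)
    (hw : w ≠ 0) (hv : v ≠ 0) (h₁ : ballSupport b x w ≤ ballSupport a y w)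
    (h₂ : ballSupport a y v ≤ ballSupport b x v) (h : expandMap a y w = expandMap b x v) :
    w = v := by
  have hwn : 0 < ‖w‖ := norm_pos_iff.mpr hw
  have hvn : 0 < ‖v‖ := norm_pos_iff.mpr hv
  have e₁ := sqrt_le_norm_expandMap_sub hw h₁
  have e₂ := sqrt_le_norm_expandMap_sub hv h₂
  rw [h, dist_expandMap_center x hv, Real.sqrt_le_sqrt_iff (by positivity)] at e₁
  rw [← h, dist_expandMap_center y hw, Real.sqrt_le_sqrt_iff (by positivity)] at e₂
  have hn : ‖w‖ = ‖v‖ := by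
    rw [← sq_eq_sq₀ hwn.le hvn.le]
    linarith
  have e₃ := mul_sqrt_le_inner_expandMap_sub hw h₁
  rw [h, expandMap, add_sub_cancel_left, inner_smul_right, hn, ← sqrt_mul_norm_eq b hv] at e₃
  have hc : 0 < √(1 + b / ‖v‖ ^ 2) := by positivity
  have e₄ : ‖v‖ * ‖v‖ ≤ ⟪w, v⟫ := by
    refine le_of_mul_le_mul_left ?_ hc
    linarith
  have e₅ : ‖w - v‖ ^ 2 ≤ 0 := by
    rw [norm_sub_sq_real, hn]
    nlinarith
  have e₆ : ‖w - v‖ = 0 := by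
    have := norm_nonneg (w - v)
    nlinarith
  exact sub_eq_zero.mp (norm_eq_zero.mp e₆)

/-- The derivative of `expandMap a y`. -/
noncomputable def expandMapDeriv (a : ℝ) (w : Plane) : Plane →L[ℝ] Plane :=
  √(1 + a / ‖w‖ ^ 2) • ContinuousLinearMap.id ℝ Plane +
    ((-(a / (√(1 + a / ‖w‖ ^ 2) * ‖w‖ ^ 4))) • innerSL ℝ w).smulRight w

lemma hasFDerivAt_expandMap {a : ℝ} (ha : 0 ≤ a) (y : Plane) {w : Plane} (hw : w ≠ 0) :
    HasFDerivAt (expandMap a y) (expandMapDeriv a w) w := by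
  have hn : 0 < ‖w‖ := norm_pos_iff.mpr hw
  have h₁ : HasFDerivAt (fun v : Plane ↦ ‖v‖ ^ 2) (2 • innerSL ℝ w) w :=
    (hasStrictFDerivAt_norm_sq w).hasFDerivAt
  have hg : HasDerivAt (fun t : ℝ ↦ √(1 + a / t))
      ((-(a / (‖w‖ ^ 2) ^ 2)) / (2 * √(1 + a / ‖w‖ ^ 2))) (‖w‖ ^ 2) := by
    refine HasDerivAt.sqrt ?_ (by positivity)
    refine HasDerivAt.const_add _ ?_
    simp only [div_eq_mul_inv, ← mul_neg]
    exact (hasDerivAt_inv (x := ‖w‖ ^ 2) (by positivity)).const_mul a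
  have h₂ := (hg.comp_hasFDerivAt w h₁).smul (hasFDerivAt_id w)
  refine (h₂.const_add y).congr_fderiv ?_
  ext1 v
  simp only [expandMapDeriv, add_apply, smul_apply,
    ContinuousLinearMap.smulRight_apply, ContinuousLinearMap.id_apply, Function.comp_apply, id,
    innerSL_apply_apply, smul_eq_mul, nsmul_eq_mul]
  congr 2
  have : 0 < √(1 + a / ‖w‖ ^ 2) := by positivity
  push_cast
  field_simp

lemma det_expandMapDeriv {a : ℝ} (ha : 0 ≤ a) {w : Plane} (hw : w ≠ 0) :
    (expandMapDeriv a w).det = 1 := by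
  have hn : 0 < ‖w‖ := norm_pos_iff.mpr hw
  have hg : 0 < √(1 + a / ‖w‖ ^ 2) := by positivity
  have hs : √(1 + a / ‖w‖ ^ 2) ^ 2 = 1 + a / ‖w‖ ^ 2 := Real.sq_sqrt (by positivity)
  have key : (expandMapDeriv a w : Plane →ₗ[ℝ] Plane) = √(1 + a / ‖w‖ ^ 2) •
      LinearMap.transvection ((-(a / (√(1 + a / ‖w‖ ^ 2) ^ 2 * ‖w‖ ^ 4))) •
        (innerSL ℝ w : Plane →ₗ[ℝ] ℝ)) w := by
    ext1 v
    simp only [expandMapDeriv, LinearMap.transvection.apply, LinearMap.smul_apply,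
      ContinuousLinearMap.coe_coe, add_apply, smul_apply,
      ContinuousLinearMap.smulRight_apply, ContinuousLinearMap.id_apply, smul_add, smul_smul,
      innerSL_apply_apply, smul_eq_mul]
    congr 2
    field_simp
  rw [ContinuousLinearMap.det, key, LinearMap.det_smul, LinearMap.transvection.det]
  simp only [finrank_euclideanSpace, Fintype.card_fin, LinearMap.smul_apply,
    ContinuousLinearMap.coe_coe, innerSL_apply_apply, real_inner_self_eq_norm_sq, smul_eq_mul]
  rw [hs]
  have : 0 < ‖w‖ ^ 2 + a := by positivity
  field_simp
  ring

lemma volume_expandMap_image {a : ℝ} (ha : 0 ≤ a) (y : Plane) {s : Set Plane}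
    (hs : MeasurableSet s) (h0 : ∀ w ∈ s, w ≠ 0) (hinj : Set.InjOn (expandMap a y) s) :
    volume (expandMap a y '' s) = volume s := by
  rw [← lintegral_abs_det_fderiv_eq_addHaar_image volume hs
    (fun w hw ↦ (hasFDerivAt_expandMap ha y (h0 w hw)).hasFDerivWithinAt) hinj]
  rw [setLIntegral_congr_fun hs (g := fun _ ↦ 1)]
  · simp
  · intro w hw
    simp [det_expandMapDeriv ha (h0 w hw)]

lemma measurable_expandMap (a : ℝ) (y : Plane) : Measurable (expandMap a y) := by
  unfold expandMap
  fun_prop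

lemma continuous_ballSupport (a : ℝ) (y : Plane) : Continuous (ballSupport a y) := by
  unfold ballSupport
  fun_prop

/-- Adding `δ` to the squared radii of a finite nonempty family of discs adds at least `π δ` to
the area of their union. -/
lemma volume_iUnion_ball_add_le {n : ℕ} [NeZero n] (y : Fin n → Plane) (a : Fin n → ℝ)
    (ha : ∀ i, 0 ≤ a i) {δ : ℝ} (hδ : 0 ≤ δ) :
    volume (⋃ i, ball (y i) √(a i)) + ENNReal.ofReal (Real.pi * δ) ≤
      volume (⋃ i, ball (y i) √(a i + δ)) := by
  classical
  set D : Set Plane := ball 0 √δ \ {0}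
  have hD : volume D = ENNReal.ofReal (Real.pi * δ) := by
    rw [measure_sdiff_null (by simp), EuclideanSpace.volume_ball_fin_two,
      ← ENNReal.ofReal_pow (Real.sqrt_nonneg _), Real.sq_sqrt hδ, mul_comm Real.pi,
      ENNReal.ofReal_mul hδ]
  let V : Fin n → Set Plane := fun i ↦
    D ∩ {w | ∀ j, ballSupport (a j) (y j) w ≤ ballSupport (a i) (y i) w}
  have hVm : ∀ i, MeasurableSet (V i) := by
    intro i
    refine (measurableSet_ball.diff (measurableSet_singleton _)).inter ?_
    rw [Set.ofPred_forall]
    exact MeasurableSet.iInter fun j ↦ (isClosed_le (continuous_ballSupport _ _)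
      (continuous_ballSupport _ _)).measurableSet
  have hVD : (⋃ i, V i) = D := by
    refine Set.Subset.antisymm (Set.iUnion_subset fun i ↦ Set.inter_subset_left) fun w hw ↦ ?_
    obtain ⟨i, hi⟩ := Finite.exists_max fun j ↦ ballSupport (a j) (y j) w
    exact Set.mem_iUnion.mpr ⟨i, hw, hi⟩
  let W : Fin n → Set Plane := disjointed V
  have hWV : ∀ i, W i ⊆ V i := fun i ↦ disjointed_subset V i
  have hWm : ∀ i, MeasurableSet (W i) := fun i ↦
    disjointedRec (fun _ j ht ↦ ht.diff (hVm j)) (hVm i)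
  have hW0 : ∀ i, ∀ w ∈ W i, w ≠ 0 := fun i w hw ↦ (hWV i hw).1.2
  have hWd : Pairwise (Function.onFun Disjoint W) := disjoint_disjointed V
  have hinj : ∀ i j w v, w ∈ W i → v ∈ W j →
      expandMap (a i) (y i) w = expandMap (a j) (y j) v → w = v := by
    intro i j w v hw hv h
    exact expandMap_injective (ha i) (ha j) (hW0 i w hw) (hW0 j v hv) ((hWV i hw).2 j)
      ((hWV j hv).2 i) h
  let I : Fin n → Set Plane := fun i ↦ expandMap (a i) (y i) '' W i
  have hIv : ∀ i, volume (I i) = volume (W i) := fun i ↦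
    volume_expandMap_image (ha i) (y i) (hWm i) (hW0 i) fun w hw v hv h ↦ hinj i i w v hw hv h
  have hIm : ∀ i, MeasurableSet (I i) := fun i ↦
    (hWm i).image_of_measurable_injOn (measurable_expandMap _ _)
      fun w hw v hv h ↦ hinj i i w v hw hv h
  have hId : Pairwise (Function.onFun Disjoint I) := by
    intro i j hij
    refine Set.disjoint_left.mpr ?_
    rintro _ ⟨w, hw, rfl⟩ ⟨v, hv, h⟩
    have := hinj j i v w hv hw h
    subst this
    exact Set.disjoint_left.mp (hWd hij) hw hv
  have hI : volume (⋃ i, I i) = ENNReal.ofReal (Real.pi * δ) := by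
    rw [measure_iUnion hId hIm]
    simp_rw [hIv]
    rw [← measure_iUnion hWd hWm, ← hD, ← hVD]
    exact congrArg _ iUnion_disjointed
  rw [← hI, ← measure_union _ (MeasurableSet.iUnion hIm)]
  · refine measure_mono (Set.union_subset (Set.iUnion_mono fun i ↦
      ball_subset_ball (Real.sqrt_le_sqrt (by linarith))) (Set.iUnion_mono fun i ↦ ?_))
    rintro _ ⟨w, hw, rfl⟩
    rw [mem_ball, dist_eq_norm, dist_expandMap_center _ (hW0 i w hw)]
    have hwδ : ‖w‖ < √δ := by simpa using (hWV i hw).1.1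
    refine Real.sqrt_lt_sqrt (by have := ha i; positivity) ?_
    have := (Real.lt_sqrt (norm_nonneg w)).mp hwδ
    linarith
  · refine Set.disjoint_iUnion_left.mpr fun j ↦ Set.disjoint_iUnion_right.mpr fun i ↦
      Set.disjoint_left.mpr ?_
    rintro _ hz ⟨w, hw, rfl⟩
    rw [mem_ball, dist_eq_norm] at hz
    have h₁ := sqrt_le_norm_expandMap_sub (hW0 i w hw) ((hWV i hw).2 j)
    have h₂ : √(a j) ≤ √(a j + ‖w‖ ^ 2) := Real.sqrt_le_sqrt (by nlinarith [norm_nonneg w])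
    linarith

/-- Adding `δ` to the squared radii of a nonempty family of discs adds at least `π δ` to
the area of their union. -/
lemma volume_biUnion_ball_add_le {Y : Set Plane} (hY : Y.Nonempty) {a : Plane → ℝ}
    (ha : ∀ y ∈ Y, 0 ≤ a y) {δ : ℝ} (hδ : 0 ≤ δ) :
    volume (⋃ y ∈ Y, ball y √(a y)) + ENNReal.ofReal (Real.pi * δ) ≤
      volume (⋃ y ∈ Y, ball y √(a y + δ)) := by
  classical
  have hfin : ∀ t : Finset Plane, t.Nonempty → (t : Set Plane) ⊆ Y →
      volume (⋃ y ∈ t, ball y √(a y)) + ENNReal.ofReal (Real.pi * δ) ≤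
        volume (⋃ y ∈ Y, ball y √(a y + δ)) := by
    intro t ht htY
    have : NeZero t.card := ⟨ht.card_ne_zero⟩
    have h := volume_iUnion_ball_add_le (fun i ↦ (t.equivFin.symm i : Plane))
      (fun i ↦ a (t.equivFin.symm i)) (fun i ↦ ha _ (htY (t.equivFin.symm i).2)) hδ
    refine le_trans ?_ (h.trans (measure_mono (Set.iUnion_subset fun i ↦
      Set.subset_biUnion_of_mem (u := fun y ↦ ball y √(a y + δ))
        (htY (t.equivFin.symm i).2))))
    gcongr
    refine Set.iUnion₂_subset fun y hy ↦ ?_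
    refine Set.subset_iUnion_of_subset (t.equivFin ⟨y, hy⟩) ?_
    simp
  have hopen : IsOpen (⋃ y ∈ Y, ball y √(a y)) := isOpen_biUnion fun _ _ ↦ isOpen_ball
  obtain ⟨y₀, hy₀⟩ := hY
  have hle : ENNReal.ofReal (Real.pi * δ) ≤ volume (⋃ y ∈ Y, ball y √(a y + δ)) :=
    le_add_self.trans (hfin {y₀} (by simp) (by simpa using hy₀))
  refine add_le_of_le_tsub_right_of_le hle ?_
  rw [hopen.measure_eq_iSup_isCompact]
  refine iSup₂_le fun Q hQ ↦ iSup_le fun hQc ↦ ?_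
  obtain ⟨t, htY, htf, ht⟩ := hQc.elim_finite_subcover_image (b := Y)
    (c := fun y ↦ ball y √(a y)) (fun _ _ ↦ isOpen_ball) hQ
  refine ENNReal.le_sub_of_add_le_right ENNReal.ofReal_ne_top ?_
  refine le_trans ?_ (hfin (insert y₀ htf.toFinset) (Finset.insert_nonempty _ _) ?_)
  · gcongr
    refine ht.trans (Set.iUnion₂_subset fun y hy ↦ ?_)
    exact Set.subset_biUnion_of_mem (u := fun y ↦ ball y √(a y)) (by simp [hy])
  · intro y hy
    simp only [Finset.coe_insert, Set.Finite.coe_toFinset, Set.mem_insert_iff] at hy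
    rcases hy with rfl | hy
    exacts [hy₀, htY hy]

lemma le_volume_biUnion_ball_diff {Y : Set Plane} (hY : Y.Nonempty) {a : Plane → ℝ}
    (ha : ∀ y ∈ Y, 0 ≤ a y) {δ : ℝ} (hδ : 0 ≤ δ)
    (hfin : volume (⋃ y ∈ Y, ball y √(a y)) ≠ ⊤) :
    ENNReal.ofReal (Real.pi * δ) ≤
      volume ((⋃ y ∈ Y, ball y √(a y + δ)) \ ⋃ y ∈ Y, ball y √(a y)) := by
  refine le_trans ?_ le_measure_sdiff
  refine ENNReal.le_sub_of_add_le_left hfin ?_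
  exact volume_biUnion_ball_add_le hY ha hδ

lemma mem_cthickening_iff_infDist_le {K : Set Plane} (hK : K.Nonempty) {r : ℝ} (hr : 0 ≤ r)
    {x : Plane} : x ∈ cthickening r K ↔ infDist x K ≤ r := by
  rw [mem_cthickening_iff, infDist, ENNReal.le_ofReal_iff_toReal_le (infEDist_ne_top hK) hr]

lemma mk_eq_mk_of_segment_subset {A : Set Plane} {x y : ↥A}
    (h : segment ℝ (x : Plane) y ⊆ A) :
    (ConnectedComponents.mk x : ConnectedComponents ↥A) = ConnectedComponents.mk y := by
  have hpre : IsPreconnected ((↑) ⁻¹' segment ℝ (x : Plane) y : Set ↥A) := by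
    rw [← Topology.IsInducing.subtypeVal.isPreconnected_image, Subtype.image_preimage_coe,
      Set.inter_eq_right.mpr h]
    exact (convex_segment _ _).isPreconnected
  exact ConnectedComponents.coe_eq_coe'.mpr
    (hpre.subset_connectedComponent (right_mem_segment ℝ _ _) (left_mem_segment ℝ _ _))

/-- The union of the discs centred at `y ∈ Y` with squared radius `d(y, K)² - r²`. -/
def powerUnion (K : Set Plane) (r : ℝ) (Y : Set Plane) : Set Plane :=
  ⋃ y ∈ Y, ball y √(infDist y K ^ 2 - r ^ 2)

lemma isOpen_powerUnion (K : Set Plane) (r : ℝ) (Y : Set Plane) : IsOpen (powerUnion K r Y) :=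
  isOpen_biUnion fun _ _ ↦ isOpen_ball

lemma powerUnion_mono (K : Set Plane) (r : ℝ) {Y Z : Set Plane} (h : Y ⊆ Z) :
    powerUnion K r Y ⊆ powerUnion K r Z :=
  Set.biUnion_subset_biUnion_left h

lemma ball_power_anti (K : Set Plane) {r s : ℝ} (hr : 0 ≤ r) (hrs : r ≤ s) (y : Plane) :
    ball y √(infDist y K ^ 2 - s ^ 2) ⊆ ball y √(infDist y K ^ 2 - r ^ 2) :=
  ball_subset_ball (Real.sqrt_le_sqrt (by nlinarith))

lemma segment_subset_of_power_balls_inter {K : Set Plane} (hK : IsCompact K) (hne : K.Nonempty)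
    {r : ℝ} (hr : 0 ≤ r) {x y z : Plane} (hx : r < infDist x K) (hy : r < infDist y K)
    (hzx : z ∈ ball x √(infDist x K ^ 2 - r ^ 2)) (hzy : z ∈ ball y √(infDist y K ^ 2 - r ^ 2)) :
    segment ℝ x y ⊆ {w | r < infDist w K} := by
  rintro w ⟨a, b, ha, hb, hab, rfl⟩
  obtain ⟨k, hk, hwk⟩ := hK.exists_infDist_eq_dist hne (a • x + b • y)
  have hxk : infDist x K ≤ ‖x - k‖ := by
    rw [← dist_eq_norm]
    exact infDist_le_dist_of_mem hk
  have hyk : infDist y K ≤ ‖y - k‖ := by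
    rw [← dist_eq_norm]
    exact infDist_le_dist_of_mem hk
  have hxy : ‖x - y‖ < √(infDist x K ^ 2 - r ^ 2) + √(infDist y K ^ 2 - r ^ 2) := by
    rw [← dist_eq_norm]
    exact (dist_triangle_left x y z).trans_lt (add_lt_add hzx hzy)
  have hs : √(infDist x K ^ 2 - r ^ 2) ^ 2 = infDist x K ^ 2 - r ^ 2 :=
    Real.sq_sqrt (by nlinarith)
  have ht : √(infDist y K ^ 2 - r ^ 2) ^ 2 = infDist y K ^ 2 - r ^ 2 :=
    Real.sq_sqrt (by nlinarith)
  have hs0 := Real.sqrt_nonneg (infDist x K ^ 2 - r ^ 2)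
  have ht0 := Real.sqrt_nonneg (infDist y K ^ 2 - r ^ 2)
  set s := √(infDist x K ^ 2 - r ^ 2)
  set t := √(infDist y K ^ 2 - r ^ 2)
  have hstewart : ‖a • x + b • y - k‖ ^ 2 =
      a * ‖x - k‖ ^ 2 + b * ‖y - k‖ ^ 2 - a * b * ‖x - y‖ ^ 2 := by
    have e₁ : a • x + b • y - k = a • (x - k) + b • (y - k) := by
      obtain rfl : b = 1 - a := by linarith
      module
    have e₂ : x - y = (x - k) - (y - k) := by abel
    rw [e₁, e₂, norm_add_sq_real, norm_sub_sq_real (x - k) (y - k), norm_smul, norm_smul, inner_smul_left,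
      inner_smul_right, Real.norm_of_nonneg ha, Real.norm_of_nonneg hb]
    obtain rfl : b = 1 - a := by linarith
    simp only [conj_trivial]
    ring
  change r < infDist _ K
  rw [hwk, dist_eq_norm]
  refine lt_of_pow_lt_pow_left₀ 2 (norm_nonneg _) ?_
  rw [hstewart]
  have hxk2 : s ^ 2 + r ^ 2 ≤ ‖x - k‖ ^ 2 := by
    rw [hs, sub_add_cancel]
    gcongr
    exact infDist_nonneg
  have hyk2 : t ^ 2 + r ^ 2 ≤ ‖y - k‖ ^ 2 := by
    rw [ht, sub_add_cancel]
    gcongr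
    exact infDist_nonneg
  have hxy2 : ‖x - y‖ ^ 2 < (s + t) ^ 2 := by
    gcongr
  have hspos : 0 < s ^ 2 := by rw [hs]; nlinarith
  have htpos : 0 < t ^ 2 := by rw [ht]; nlinarith
  have hlow : a * (s ^ 2 + r ^ 2) + b * (t ^ 2 + r ^ 2) ≤ a * ‖x - k‖ ^ 2 + b * ‖y - k‖ ^ 2 := by
    gcongr
  suffices a * b * ‖x - y‖ ^ 2 < a * s ^ 2 + b * t ^ 2 by
    have : a * r ^ 2 + b * r ^ 2 = r ^ 2 := by rw [← add_mul, hab, one_mul]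
    linarith
  rcases ha.eq_or_lt with rfl | ha
  · obtain rfl : b = 1 := by linarith
    simpa using htpos
  rcases hb.eq_or_lt with rfl | hb
  · obtain rfl : a = 1 := by linarith
    simpa using hspos
  calc a * b * ‖x - y‖ ^ 2 < a * b * (s + t) ^ 2 := by gcongr
    _ ≤ a * b * (s + t) ^ 2 + (a * s - b * t) ^ 2 := by nlinarith [sq_nonneg (a * s - b * t)]
    _ = a * s ^ 2 + b * t ^ 2 := by
      obtain rfl : b = 1 - a := by linarith
      ring

lemma volume_powerUnion_ne_top {K : Set Plane} (hne : K.Nonempty) (r : ℝ) {Y : Set Plane}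
    (hY : Bornology.IsBounded Y) : volume (powerUnion K r Y) ≠ ⊤ := by
  obtain ⟨k, hk⟩ := hne
  obtain ⟨M, hM⟩ := hY.subset_closedBall k
  refine ((measure_mono (?_ : _ ⊆ closedBall k (M + M))).trans_lt
    (isCompact_closedBall k _).measure_lt_top).ne
  refine Set.iUnion₂_subset fun y hy z hz ↦ ?_
  have hyM : dist y k ≤ M := hM hy
  have hd : infDist y K ≤ M := (infDist_le_dist_of_mem hk).trans hyM
  have hz' : dist z y < infDist y K := by
    refine lt_of_lt_of_le hz ?_
    rw [Real.sqrt_le_left infDist_nonneg]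
    nlinarith
  rw [mem_closedBall]
  linarith [dist_triangle z y k]

lemma le_volume_powerUnion_diff {K : Set Plane} (hne : K.Nonempty) {r s : ℝ} (hr : 0 ≤ r)
    (hrs : r ≤ s) {Y : Set Plane} (hY : Y.Nonempty) (hYb : Bornology.IsBounded Y)
    (hYs : ∀ y ∈ Y, s < infDist y K) :
    ENNReal.ofReal (Real.pi * (s ^ 2 - r ^ 2)) ≤
      volume (powerUnion K r Y \ powerUnion K s Y) := by
  have h := le_volume_biUnion_ball_diff hY (a := fun y ↦ infDist y K ^ 2 - s ^ 2)
    (fun y hy ↦ by have := hYs y hy; nlinarith) (δ := s ^ 2 - r ^ 2) (by nlinarith)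
    (volume_powerUnion_ne_top hne s hYb)
  simpa [powerUnion] using h

/-- The union of all discs centred at points `y` with `d(y, K) > r` and of squared radius
`d(y, K)² - r²`. -/
def fullPowerUnion (K : Set Plane) (r : ℝ) : Set Plane :=
  powerUnion K r {y | r < infDist y K}

lemma fullPowerUnion_anti (K : Set Plane) {r s : ℝ} (hr : 0 ≤ r) (hrs : r ≤ s) :
    fullPowerUnion K s ⊆ fullPowerUnion K r :=
  Set.iUnion₂_subset fun y hy ↦ (ball_power_anti K hr hrs y).trans
    (Set.subset_biUnion_of_mem (u := fun y ↦ ball y √(infDist y K ^ 2 - r ^ 2))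
      (hrs.trans_lt hy))

lemma infDist_le_of_notMem_fullPowerUnion {K : Set Plane} {r : ℝ} (hr : 0 ≤ r) {z : Plane}
    (hz : z ∉ fullPowerUnion K r) : infDist z K ≤ r := by
  by_contra! h
  refine hz (Set.mem_biUnion (show z ∈ {y | r < infDist y K} from h) ?_)
  exact mem_ball_self (Real.sqrt_pos.mpr (by nlinarith))

/-- The area swept by `fullPowerUnion K` just after time `r` is at least `π` per bounded hole and
unit of squared radius. -/
lemma exists_betti1_mul_le_volume_diff {K : Set Plane} (hK : IsCompact K) (hne : K.Nonempty)
    {r : ℝ} (hr : 0 ≤ r) :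
    ∃ R > r, ∀ s, r ≤ s → s < R →
      ENNReal.ofReal (betti1 (cthickening r K) * (Real.pi * (s ^ 2 - r ^ 2))) ≤
        volume (fullPowerUnion K r \ fullPowerUnion K s) := by
  classical
  by_cases h0 : betti1 (cthickening r K) = 0
  · exact ⟨r + 1, by linarith, fun s _ _ ↦ by simp [h0]⟩
  set T := {C : ConnectedComponents ↥((cthickening r K)ᶜ) //
    Bornology.IsBounded ((Subtype.val '' (ConnectedComponents.mk ⁻¹' {C})) : Set Plane)}
  have hTc : betti1 (cthickening r K) = Nat.card T := rfl
  rw [hTc] at h0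
  have : Finite T := Nat.finite_of_card_ne_zero h0
  have : Nonempty T := (Nat.card_ne_zero.mp h0).1
  have : Fintype T := Fintype.ofFinite T
  have hmem : ∀ x : Plane, x ∈ (cthickening r K)ᶜ ↔ r < infDist x K := fun x ↦ by
    rw [Set.mem_compl_iff, mem_cthickening_iff_infDist_le hne hr, not_le]
  choose p hp using fun C : T ↦ ConnectedComponents.surjective_coe C.1
  obtain ⟨C₀, hC₀⟩ := Finite.exists_min fun C : T ↦ infDist (p C : Plane) K
  refine ⟨infDist (p C₀ : Plane) K, (hmem _).mp (p C₀).2, fun s hrs hsR ↦ ?_⟩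
  let Y : T → Set Plane := fun C ↦ {y | s < infDist y K} ∩
    Subtype.val '' (ConnectedComponents.mk ⁻¹' {C.1})
  have hYne : ∀ C, (Y C).Nonempty := fun C ↦
    ⟨p C, hsR.trans_le (hC₀ C), p C, by simpa using hp C, rfl⟩
  have hYb : ∀ C, Bornology.IsBounded (Y C) := fun C ↦ C.2.subset Set.inter_subset_right
  have hYr : ∀ C, ∀ y ∈ Y C, r < infDist y K := fun C y hy ↦ hrs.trans_lt hy.1
  have hsame : ∀ C, ∀ x ∈ Y C, ∀ y z, r < infDist y K →
      z ∈ ball x √(infDist x K ^ 2 - r ^ 2) → z ∈ ball y √(infDist y K ^ 2 - r ^ 2) →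
      y ∈ Subtype.val '' (ConnectedComponents.mk ⁻¹' {C.1}) := by
    rintro C _ ⟨hxs, x, hxC, rfl⟩ y z hy hzx hzy
    refine ⟨⟨y, (hmem y).mpr hy⟩, ?_, rfl⟩
    rw [Set.mem_preimage, Set.mem_singleton_iff] at hxC ⊢
    rw [← hxC]
    refine (mk_eq_mk_of_segment_subset ?_).symm
    refine (segment_subset_of_power_balls_inter hK hne hr (hrs.trans_lt hxs) hy hzx hzy).trans ?_
    exact fun w hw ↦ (hmem w).mpr hw
  let D : T → Set Plane := fun C ↦ powerUnion K r (Y C) \ powerUnion K s (Y C)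
  have hDm : ∀ C, MeasurableSet (D C) := fun C ↦
    (isOpen_powerUnion K r _).measurableSet.diff (isOpen_powerUnion K s _).measurableSet
  have hDd : Pairwise (Function.onFun Disjoint D) := by
    intro C C' hCC'
    refine Set.disjoint_left.mpr fun z hz hz' ↦ hCC' ?_
    obtain ⟨x, hx, hzx⟩ := Set.mem_iUnion₂.mp hz.1
    obtain ⟨y, hy, hzy⟩ := Set.mem_iUnion₂.mp hz'.1
    obtain ⟨v, hv, hvy⟩ := hsame C x hx y z (hYr C' y hy) hzx hzy
    obtain ⟨v', hv', hvy'⟩ := hy.2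
    obtain rfl : v = v' := Subtype.ext (hvy.trans hvy'.symm)
    exact Subtype.ext ((Set.mem_singleton_iff.mp hv).symm.trans hv')
  have hsub : (⋃ C, D C) ⊆ fullPowerUnion K r \ fullPowerUnion K s := by
    refine Set.iUnion_subset fun C z hz ↦ ⟨powerUnion_mono K r (hYr C) hz.1, fun hzs ↦ hz.2 ?_⟩
    obtain ⟨x, hx, hzx⟩ := Set.mem_iUnion₂.mp hz.1
    obtain ⟨y, hy, hzy⟩ := Set.mem_iUnion₂.mp hzs
    refine Set.mem_biUnion (⟨hy, ?_⟩ : y ∈ Y C) hzy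
    exact hsame C x hx y z (hrs.trans_lt hy) hzx (ball_power_anti K hr hrs y hzy)
  calc ENNReal.ofReal (betti1 (cthickening r K) * (Real.pi * (s ^ 2 - r ^ 2)))
      = ∑ _C : T, ENNReal.ofReal (Real.pi * (s ^ 2 - r ^ 2)) := by
        rw [hTc, ENNReal.ofReal_mul (Nat.cast_nonneg _)]
        simp [Nat.card_eq_fintype_card]
    _ ≤ ∑ C : T, volume (D C) := by
        gcongr with C
        exact le_volume_powerUnion_diff hne hr hrs (hYne C) (hYb C) fun y hy ↦ hy.1
    _ = volume (⋃ C, D C) := by rw [measure_iUnion hDd hDm, tsum_fintype]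
    _ ≤ _ := measure_mono hsub

/-- The area of the part of `cthickening R K` not covered by `fullPowerUnion K r`. -/
noncomputable def uncoveredArea (K : Set Plane) (R r : ℝ) : ℝ :=
  volume.real (cthickening R K \ fullPowerUnion K r)

lemma volume_cthickening_diff_ne_top {K : Set Plane} (hK : IsCompact K) (R : ℝ) (A : Set Plane) :
    volume (cthickening R K \ A) ≠ ⊤ :=
  ((measure_mono Set.sdiff_subset).trans_lt hK.cthickening.measure_lt_top).ne

lemma monotoneOn_uncoveredArea {K : Set Plane} (hK : IsCompact K) (R : ℝ) :
    MonotoneOn (uncoveredArea K R) (Set.Ici 0) := fun _ hr _ _ hrs ↦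
  measureReal_mono (Set.sdiff_subset_sdiff_right (fullPowerUnion_anti K hr hrs))
    (volume_cthickening_diff_ne_top hK R _)

lemma exists_betti1_mul_le_uncoveredArea_sub {K : Set Plane} (hK : IsCompact K)
    (hne : K.Nonempty) {R r : ℝ} (hr : 0 ≤ r) (hrR : r < R) :
    ∃ R' > r, ∀ s, r ≤ s → s < R' →
      betti1 (cthickening r K) * (Real.pi * (s ^ 2 - r ^ 2)) ≤
        uncoveredArea K R s - uncoveredArea K R r := by
  obtain ⟨R', hR', h⟩ := exists_betti1_mul_le_volume_diff hK hne hr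
  refine ⟨min R R', lt_min hrR hR', fun s hrs hs ↦ ?_⟩
  have hs0 : 0 ≤ s := hr.trans hrs
  have hsub : fullPowerUnion K r \ fullPowerUnion K s ⊆ cthickening R K \ fullPowerUnion K s := by
    refine fun z hz ↦ ⟨?_, hz.2⟩
    rw [mem_cthickening_iff_infDist_le hne (hr.trans hrR.le)]
    exact (infDist_le_of_notMem_fullPowerUnion hs0 hz.2).trans (hs.le.trans (min_le_left _ _))
  have hreal : betti1 (cthickening r K) * (Real.pi * (s ^ 2 - r ^ 2)) ≤
      volume.real (fullPowerUnion K r \ fullPowerUnion K s) :=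
    (ENNReal.ofReal_le_iff_le_toReal (measure_ne_top_of_subset hsub
      (volume_cthickening_diff_ne_top hK R _))).mp (h s hrs (hs.trans_le (min_le_right _ _)))
  have hdisj : Disjoint (cthickening R K \ fullPowerUnion K r)
      (fullPowerUnion K r \ fullPowerUnion K s) :=
    Set.disjoint_left.mpr fun z hz hz' ↦ hz.2 hz'.1
  have hadd : volume.real (cthickening R K \ fullPowerUnion K r) +
      volume.real (fullPowerUnion K r \ fullPowerUnion K s) ≤
      volume.real (cthickening R K \ fullPowerUnion K s) := by
    rw [← measureReal_union hdisj ((isOpen_powerUnion K r _).measurableSet.diff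
      (isOpen_powerUnion K s _).measurableSet) (volume_cthickening_diff_ne_top hK R _)
      (measure_ne_top_of_subset hsub (volume_cthickening_diff_ne_top hK R _))]
    exact measureReal_mono (Set.union_subset
      (Set.sdiff_subset_sdiff_right (fullPowerUnion_anti K hr hrs)) hsub)
      (volume_cthickening_diff_ne_top hK R _)
  unfold uncoveredArea
  linarith

lemma betti1_le_deriv_uncoveredArea {K : Set Plane} (hK : IsCompact K) (hne : K.Nonempty)
    {r₀ R r : ℝ} (h0 : 0 ≤ r₀) (hr : r₀ ≤ r) (hrR : r < R)
    (hd : DifferentiableAt ℝ (uncoveredArea K R) r) :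
    betti1 (cthickening r K) * (2 * Real.pi * r₀) ≤ deriv (uncoveredArea K R) r := by
  have hr0 : 0 ≤ r := h0.trans hr
  obtain ⟨R', hR', h⟩ := exists_betti1_mul_le_uncoveredArea_sub hK hne hr0 hrR
  have hslope := (hasDerivAt_iff_tendsto_slope.mp hd.hasDerivAt).mono_left
    (nhdsWithin_mono r fun x (hx : x ∈ Set.Ioi r) ↦ (Set.mem_Ioi.mp hx).ne')
  refine ge_of_tendsto hslope ?_
  filter_upwards [Ioo_mem_nhdsGT hR'] with s hs
  have hsr : 0 < s - r := sub_pos.mpr hs.1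
  rw [slope_def_field, le_div_iff₀ hsr]
  refine le_trans ?_ (h s hs.1.le hs.2)
  rw [mul_assoc]
  refine mul_le_mul_of_nonneg_left ?_ (Nat.cast_nonneg _)
  have := Real.pi_pos
  nlinarith [mul_nonneg (mul_nonneg this.le hsr.le) (by linarith [hs.1] : 0 ≤ s + r - 2 * r₀)]

lemma betti1_empty : betti1 ∅ = 0 := by
  refine Nat.card_eq_zero.mpr (Or.inl ⟨fun ⟨C, hC⟩ ↦ ?_⟩)
  obtain ⟨x, rfl⟩ := ConnectedComponents.surjective_coe C
  refine NormedSpace.unbounded_univ ℝ Plane (hC.subset fun y _ ↦ ?_)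
  exact ⟨⟨y, by simp⟩, mk_eq_mk_of_segment_subset (by simp), rfl⟩

/-- For every compact `K ⊆ ℝ²` and radii `0 < r0 ≤ r1`, the integral over `r ∈ [r0, r1]`
of the first Betti number of the closed `r`-offset `K^r` is at most the Lebesgue area of
`K^{r1}` divided by `2π r0`. -/
theorem stmt0 (K : Set Plane) (hK : IsCompact K) (r0 r1 : ℝ) (h0 : 0 < r0) (h01 : r0 ≤ r1) :
    ∫ r in r0..r1, (betti1 (cthickening r K) : ℝ)
      ≤ (volume (cthickening r1 K)).toReal / (2 * Real.pi * r0) := by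
  have hc : 0 < 2 * Real.pi * r0 := by positivity
  rcases K.eq_empty_or_nonempty with rfl | hne
  · simp [betti1_empty]
  by_cases hint : IntervalIntegrable (fun r ↦ (betti1 (cthickening r K) : ℝ)) volume r0 r1
  swap
  · rw [intervalIntegral.integral_undef hint]
    positivity
  have hmono : MonotoneOn (uncoveredArea K r1) (Set.uIcc r0 r1) :=
    (monotoneOn_uncoveredArea hK r1).mono fun r hr ↦ by
      rw [Set.uIcc_of_le h01] at hr
      exact h0.le.trans hr.1
  rw [le_div_iff₀ hc, ← intervalIntegral.integral_mul_const]
  calc ∫ r in r0..r1, (betti1 (cthickening r K) : ℝ) * (2 * Real.pi * r0)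
      ≤ ∫ r in r0..r1, deriv (uncoveredArea K r1) r := by
        refine intervalIntegral.integral_mono_ae_restrict h01 (hint.mul_const _)
          hmono.intervalIntegrable_deriv ?_
        have hne₀ : ∀ᵐ r : ℝ, r ≠ r0 := by simp [ae_iff]
        have hne₁ : ∀ᵐ r : ℝ, r ≠ r1 := by simp [ae_iff]
        rw [Set.uIcc_of_le h01] at hmono
        filter_upwards [hmono.ae_differentiableWithinAt measurableSet_Icc,
          ae_restrict_of_ae hne₀, ae_restrict_of_ae hne₁,
          ae_restrict_mem measurableSet_Icc] with r hdiff hr0 hr1 hr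
        have hl : r0 < r := lt_of_le_of_ne hr.1 (Ne.symm hr0)
        have hu : r < r1 := lt_of_le_of_ne hr.2 hr1
        exact betti1_le_deriv_uncoveredArea hK hne h0.le hl.le hu
          (hdiff.differentiableAt (Icc_mem_nhds hl hu))
    _ ≤ uncoveredArea K r1 r1 - uncoveredArea K r1 r0 := by
        have h := hmono.intervalIntegral_deriv_mem_uIcc
        rw [Set.uIcc_of_le (sub_nonneg.mpr (hmono (by simp) (by simp) h01))] at h
        exact h.2
    _ ≤ uncoveredArea K r1 r1 := sub_le_self _ measureReal_nonneg
    _ ≤ (volume (cthickening r1 K)).toReal :=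
        measureReal_mono Set.sdiff_subset hK.cthickening.measure_lt_top.ne
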